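/- For every integer n ≥ 4, there exists a finite list L of 2^n × 2^n matrices, each of which is a gate embedding H_i, (Z_{2^k})_i, (Z_{2^k}†)_i (k ≥ 1) or CNOT_{i,j}, such that the product of the matrices in L equals the n-MCT matrix and the number of entries of L that are phase-gate embeddings (Z_{2^k})_i or (Z_{2^k}†)_i is at most 2n² + n − 16; in particular the n-MCT gate can be realized ancilla-free over the Clifford+Z_N library with phase count O(n²). -/

import Mathlib

/-!
Gates are represented as matrices indexed by `Bool` (single qubit, so a 2×2 matrix)
or by `Fin n → Bool` (n qubits, so a 2^n × 2^n matrix). The basis index `true`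
corresponds to the basis state |1⟩ and `false` to |0⟩.
-/

namespace MCT

/-- The Hadamard gate `H = (1/√2)·[[1,1],[1,−1]]`. -/
noncomputable def Hg : Matrix Bool Bool ℂ :=
  fun a b => (1 / (Real.sqrt 2 : ℂ)) * (if a && b then -1 else 1)

/-- The phase gate `Z_N = diag(1, exp(iπ/N))`. -/
noncomputable def Zg (N : ℕ) : Matrix Bool Bool ℂ :=
  fun a b => if a = b then (if a then Complex.exp (Real.pi * Complex.I / N) else 1) else 0

/-- The adjoint phase gate `Z_N† = diag(1, exp(−iπ/N))`. -/
noncomputable def Zgd (N : ℕ) : Matrix Bool Bool ℂ :=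
  fun a b => if a = b then (if a then Complex.exp (-(Real.pi * Complex.I) / N) else 1) else 0

/-- Embedding `G_i = I₂^{⊗(i−1)} ⊗ G ⊗ I₂^{⊗(n−i)}` of a single-qubit gate `G`
on qubit `i` of `n` qubits. -/
noncomputable def embed {n : ℕ} (G : Matrix Bool Bool ℂ) (i : Fin n) :
    Matrix (Fin n → Bool) (Fin n → Bool) ℂ :=
  fun x y => (if ∀ j, j ≠ i → x j = y j then 1 else 0) * G (x i) (y i)

/-- `CNOT_{i,j}`: the permutation matrix mapping the basis state `y` to the state
with `y j` replaced by `y j ⊕ y i` (control `i`, target `j`). -/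
def cnot {n : ℕ} (i j : Fin n) : Matrix (Fin n → Bool) (Fin n → Bool) ℂ :=
  fun x y => if (∀ k, k ≠ j → x k = y k) ∧ x j = xor (y j) (y i) then 1 else 0

/-- The function on basis states realized by the `n`-MCT gate: the last bit is
XORed with the product (conjunction) of the first `n−1` bits. -/
def mctFun (n : ℕ) (y : Fin n → Bool) : Fin n → Bool :=
  fun k => if (k : ℕ) = n - 1 then
      xor (y k) (decide (∀ j : Fin n, (j : ℕ) < n - 1 → y j = true))
    else y k

/-- The `n`-MCT matrix: the permutation matrix mapping basis state
`|x₁…x_n⟩` to `|x₁…x_{n−1}, x_n ⊕ (x₁⋯x_{n−1})⟩`. -/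
def mct (n : ℕ) : Matrix (Fin n → Bool) (Fin n → Bool) ℂ :=
  fun x y => if x = mctFun n y then 1 else 0

/-- A description of a Clifford+`Z_N` gate on `n` qubits: a Hadamard `H_i`,
a phase gate `(Z_{2^k})_i`, an adjoint phase gate `(Z_{2^k}†)_i`, or a `CNOT_{i,j}`. -/
inductive GateDesc (n : ℕ) where
  | h (i : Fin n)
  | z (k : ℕ) (i : Fin n)
  | zd (k : ℕ) (i : Fin n)
  | cx (i j : Fin n)

/-- Validity of a gate description: phase gates need `k ≥ 1` and CNOTs need `i ≠ j`. -/
def GateDesc.valid {n : ℕ} : GateDesc n → Prop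
  | .h _ => True
  | .z k _ => 1 ≤ k
  | .zd k _ => 1 ≤ k
  | .cx i j => i ≠ j

/-- The matrix denoted by a gate description. -/
noncomputable def GateDesc.interp {n : ℕ} : GateDesc n → Matrix (Fin n → Bool) (Fin n → Bool) ℂ
  | .h i => embed Hg i
  | .z k i => embed (Zg (2 ^ k)) i
  | .zd k i => embed (Zgd (2 ^ k)) i
  | .cx i j => cnot i j

/-- Whether a gate description is a phase gate `(Z_{2^k})_i` or `(Z_{2^k}†)_i`. -/
def GateDesc.isPhase {n : ℕ} : GateDesc n → Bool
  | .z _ _ => true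
  | .zd _ _ => true
  | _ => false

/-! ### Monomial matrices -/

/-- The monomial matrix mapping the basis state `y` to `exp(i φ(y))` times the basis state `σ y`. -/
noncomputable def mono {n : ℕ} (σ : (Fin n → Bool) → (Fin n → Bool)) (φ : (Fin n → Bool) → ℝ) :
    Matrix (Fin n → Bool) (Fin n → Bool) ℂ :=
  fun x y => if x = σ y then Complex.exp (φ y * Complex.I) else 0

/-- The value of a bit as a real number. -/
def bit (b : Bool) : ℝ := if b then 1 else 0

@[simp] lemma bit_true : bit true = 1 := rfl

@[simp] lemma bit_false : bit false = 0 := rfl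

lemma bit_xor (a b : Bool) : bit (xor a b) = bit a + bit b - 2 * (bit a * bit b) := by
  cases a <;> cases b <;> norm_num

lemma mono_mul {n : ℕ} (σ τ : (Fin n → Bool) → (Fin n → Bool)) (φ ψ : (Fin n → Bool) → ℝ) :
    mono σ φ * mono τ ψ = mono (σ ∘ τ) (fun y => φ (τ y) + ψ y) := by
  ext x y
  rw [Matrix.mul_apply, Finset.sum_eq_single (τ y)]
  · by_cases h : x = σ (τ y)
    · simp [mono, h, ← Complex.exp_add, add_mul]
    · simp [mono, h]
  · intro z _ hz
    simp [mono, hz]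
  · simp

lemma mono_id_zero {n : ℕ} : mono (n := n) id (fun _ => 0) = 1 := by
  ext x y
  simp [mono, Matrix.one_apply]

lemma embed_mul_apply {n : ℕ} (G : Matrix Bool Bool ℂ) (t : Fin n)
    (A : Matrix (Fin n → Bool) (Fin n → Bool) ℂ) (x y : Fin n → Bool) :
    (embed G t * A) x y = G (x t) true * A (Function.update x t true) y +
      G (x t) false * A (Function.update x t false) y := by
  rw [Matrix.mul_apply, Fintype.sum_eq_add (Function.update x t true) (Function.update x t false)]
  · simp +contextual [embed]
  · intro h
    simpa using congrFun h t
  · rintro z ⟨h1, h2⟩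
    have : ¬ ∀ j, j ≠ t → x j = z j := by
      intro h
      cases hz : z t
      · refine h2 (funext fun j => ?_)
        by_cases hj : j = t
        · subst hj; simp [hz]
        · simp [hj, h j hj]
      · refine h1 (funext fun j => ?_)
        by_cases hj : j = t
        · subst hj; simp [hz]
        · simp [hj, h j hj]
    simp [embed, this]

lemma mul_embed_apply {n : ℕ} (G : Matrix Bool Bool ℂ) (t : Fin n)
    (A : Matrix (Fin n → Bool) (Fin n → Bool) ℂ) (x y : Fin n → Bool) :
    (A * embed G t) x y = A x (Function.update y t true) * G true (y t) +
      A x (Function.update y t false) * G false (y t) := by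
  rw [Matrix.mul_apply, Fintype.sum_eq_add (Function.update y t true) (Function.update y t false)]
  · simp +contextual [embed]
  · intro h
    simpa using congrFun h t
  · rintro z ⟨h1, h2⟩
    have : ¬ ∀ j, j ≠ t → z j = y j := by
      intro h
      cases hz : z t
      · refine h2 (funext fun j => ?_)
        by_cases hj : j = t
        · subst hj; simp [hz]
        · simp [hj, h j hj]
      · refine h1 (funext fun j => ?_)
        by_cases hj : j = t
        · subst hj; simp [hz]
        · simp [hj, h j hj]
    simp [embed, this]

lemma update_eq_update_iff {n : ℕ} (x z : Fin n → Bool) (t : Fin n) (b c : Bool) :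
    Function.update x t b = Function.update z t c ↔ b = c ∧ ∀ j, j ≠ t → x j = z j := by
  constructor
  · intro h
    refine ⟨by simpa using congrFun h t, fun j hj => ?_⟩
    simpa [hj] using congrFun h j
  · rintro ⟨rfl, h⟩
    funext j
    by_cases hj : j = t
    · subst hj; simp
    · simp [hj, h j hj]

/-- Conjugating by a Hadamard gate turns a conditional sign on qubit `t` into a conditional flip. -/
lemma hadamard_conj {n : ℕ} (t : Fin n) (σ : (Fin n → Bool) → (Fin n → Bool))
    (φ φ₀ : (Fin n → Bool) → ℝ) (f : (Fin n → Bool) → Bool)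
    (hφ : ∀ y, φ y = φ₀ y + Real.pi * (bit (y t) * bit (f y)))
    (hσ : ∀ y b, σ (Function.update y t b) = Function.update (σ y) t b)
    (hφ₀ : ∀ y b, φ₀ (Function.update y t b) = φ₀ y)
    (hf : ∀ y b, f (Function.update y t b) = f y) :
    embed Hg t * (mono σ φ * embed Hg t) =
      mono (fun y => Function.update (σ y) t (xor (y t) (f y))) φ₀ := by
  have hs : ((Real.sqrt 2 : ℝ) : ℂ)⁻¹ * ((Real.sqrt 2 : ℝ) : ℂ)⁻¹ = 1 / 2 := by
    rw [← mul_inv, ← Complex.ofReal_mul, Real.mul_self_sqrt (by norm_num)]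
    norm_num
  have he : ∀ a : ℂ, Complex.exp ((a + Real.pi) * Complex.I) = - Complex.exp (a * Complex.I) := by
    intro a
    rw [add_mul, Complex.exp_add, Complex.exp_pi_mul_I]
    ring
  ext x y
  have hx : ∀ c, x = Function.update (σ y) t c ↔ x t = c ∧ ∀ j, j ≠ t → x j = σ y j := by
    intro c
    have := update_eq_update_iff x (σ y) t (x t) c
    rwa [Function.update_eq_self] at this
  rw [embed_mul_apply, mul_embed_apply, mul_embed_apply]
  simp only [mono, hσ, hφ, hφ₀, hf, update_eq_update_iff, hx, Function.update_self]
  by_cases h : ∀ j, j ≠ t → x j = σ y j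
  · generalize φ₀ y = a
    simp only [eq_true h, and_true]
    cases x t <;> cases y t <;> cases f y <;> simp [Hg, he] <;>
      linear_combination (2 * Complex.exp (a * Complex.I)) * hs
  · simp [h]

/-! ### Circuits -/

/-- `Impl M c`: some circuit with at most `c` phase gates has matrix `M`. -/
def Impl {n : ℕ} (M : Matrix (Fin n → Bool) (Fin n → Bool) ℂ) (c : ℕ) : Prop :=
  ∃ L : List (GateDesc n), (∀ g ∈ L, g.valid) ∧ (L.map GateDesc.interp).prod = M ∧
    L.countP GateDesc.isPhase ≤ c

lemma Impl.mul {n : ℕ} {M N : Matrix (Fin n → Bool) (Fin n → Bool) ℂ} {c d : ℕ}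
    (hM : Impl M c) (hN : Impl N d) : Impl (M * N) (c + d) := by
  obtain ⟨L, h1, h2, h3⟩ := hM
  obtain ⟨K, k1, k2, k3⟩ := hN
  refine ⟨L ++ K, ?_, by simp [h2, k2], by simpa using Nat.add_le_add h3 k3⟩
  intro g hg
  rcases List.mem_append.1 hg with hg | hg
  exacts [h1 g hg, k1 g hg]

lemma Impl.gate {n : ℕ} (g : GateDesc n) (hg : g.valid) :
    Impl g.interp (if g.isPhase then 1 else 0) :=
  ⟨[g], by simpa using hg, by simp, by cases h : g.isPhase <;> simp [h]⟩

lemma impl_hadamard {n : ℕ} (t : Fin n) : Impl (embed Hg t) 0 :=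
  Impl.gate (.h t) trivial

lemma impl_one {n : ℕ} : Impl (1 : Matrix (Fin n → Bool) (Fin n → Bool) ℂ) 0 :=
  ⟨[], by simp, by simp, by simp⟩

lemma cnot_eq_mono {n : ℕ} (i j : Fin n) :
    cnot i j = mono (fun y => Function.update y j (xor (y j) (y i))) (fun _ => 0) := by
  ext x y
  have := update_eq_update_iff x y j (x j) (xor (y j) (y i))
  rw [Function.update_eq_self] at this
  simp only [mono, cnot, this]
  simp [and_comm]

lemma impl_cnot {n : ℕ} (i j : Fin n) (h : i ≠ j) :
    Impl (mono (fun y => Function.update y j (xor (y j) (y i))) (fun _ => 0)) 0 := by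
  rw [← cnot_eq_mono]
  exact Impl.gate (.cx i j) h

lemma embed_Zg_eq_mono {n : ℕ} (k : ℕ) (i : Fin n) :
    embed (Zg (2 ^ k)) i = mono id (fun y => Real.pi / 2 ^ k * bit (y i)) := by
  ext x y
  have := update_eq_update_iff x y i (x i) (y i)
  rw [Function.update_eq_self, Function.update_eq_self] at this
  simp only [embed, mono, Zg, id, this]
  by_cases h : ∀ j, j ≠ i → x j = y j
  · simp only [eq_true h, and_true]
    cases x i <;> cases y i <;> simp
    congr 1
    ring
  · simp [h]

lemma embed_Zgd_eq_mono {n : ℕ} (k : ℕ) (i : Fin n) :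
    embed (Zgd (2 ^ k)) i = mono id (fun y => -(Real.pi / 2 ^ k * bit (y i))) := by
  ext x y
  have := update_eq_update_iff x y i (x i) (y i)
  rw [Function.update_eq_self, Function.update_eq_self] at this
  simp only [embed, mono, Zgd, id, this]
  by_cases h : ∀ j, j ≠ i → x j = y j
  · simp only [eq_true h, and_true]
    cases x i <;> cases y i <;> simp
    congr 1
    ring
  · simp [h]

/-- The gate inverse to a given one. -/
def GateDesc.inv {n : ℕ} : GateDesc n → GateDesc n
  | .h i => .h i
  | .z k i => .zd k i
  | .zd k i => .z k i
  | .cx i j => .cx i j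

lemma GateDesc.inv_interp_mul {n : ℕ} (g : GateDesc n) (hg : g.valid) :
    g.inv.interp * g.interp = 1 := by
  rw [← mono_id_zero]
  cases g with
  | h i =>
    have := hadamard_conj i id (fun _ => 0) (fun _ => 0) (fun _ => false) (by simp) (by simp)
      (by simp) (by simp)
    rw [mono_id_zero, one_mul] at this
    simp only [GateDesc.inv, GateDesc.interp, this]
    congr 1
    funext y
    simp
  | z k i => simp [GateDesc.inv, GateDesc.interp, embed_Zg_eq_mono, embed_Zgd_eq_mono, mono_mul]
  | zd k i => simp [GateDesc.inv, GateDesc.interp, embed_Zg_eq_mono, embed_Zgd_eq_mono, mono_mul]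
  | cx i j =>
    have hij : i ≠ j := hg
    simp only [GateDesc.inv, GateDesc.interp, cnot_eq_mono, mono_mul]
    congr 1
    · funext y
      simp [hij]
    · simp

lemma Impl.exists_inv {n : ℕ} {M : Matrix (Fin n → Bool) (Fin n → Bool) ℂ} {c : ℕ}
    (hM : Impl M c) : ∃ N, N * M = 1 ∧ Impl N c := by
  obtain ⟨L, h1, rfl, h3⟩ := hM
  suffices h : ∃ N, N * (L.map GateDesc.interp).prod = 1 ∧
      Impl N (L.countP GateDesc.isPhase) by
    obtain ⟨N, hN, K, k1, k2, k3⟩ := h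
    exact ⟨N, hN, K, k1, k2, k3.trans h3⟩
  clear h3
  induction L with
  | nil => exact ⟨1, by simp, by simpa using impl_one⟩
  | cons g L ih =>
    obtain ⟨N, hN, hI⟩ := ih fun g' hg' => h1 g' (List.mem_cons_of_mem _ hg')
    have hg : g.valid := h1 g List.mem_cons_self
    refine ⟨N * g.inv.interp, ?_, ?_⟩
    · rw [List.map_cons, List.prod_cons, mul_assoc, ← mul_assoc g.inv.interp,
        g.inv_interp_mul hg, one_mul, hN]
    · have hv : g.inv.valid := by cases g <;> exact hg
      have hp : g.inv.isPhase = g.isPhase := by cases g <;> rfl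
      have := hI.mul (Impl.gate g.inv hv)
      rwa [hp, ← List.countP_cons] at this

/-! ### Diagonal circuits -/

lemma Impl.diag_add {n : ℕ} {φ ψ : (Fin n → Bool) → ℝ} {c d : ℕ}
    (h₁ : Impl (mono id φ) c) (h₂ : Impl (mono id ψ) d) :
    Impl (mono id (fun y => φ y + ψ y)) (c + d) := by
  simpa [mono_mul] using h₁.mul h₂

lemma Impl.diag_neg {n : ℕ} {φ : (Fin n → Bool) → ℝ} {c : ℕ}
    (h : Impl (mono id φ) c) : Impl (mono id (fun y => -φ y)) c := by
  obtain ⟨N, hN, hI⟩ := h.exists_inv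
  have h2 : mono id φ * mono id (fun y => -φ y) = 1 := by
    simp [mono_mul, mono_id_zero]
  rwa [left_inv_eq_right_inv hN h2] at hI

lemma Impl.diag_sum {n : ℕ} (φ : ℕ → (Fin n → Bool) → ℝ) (p : ℕ)
    (h : ∀ j < p, Impl (mono id (φ j)) 1) :
    Impl (mono id (fun y => ∑ j ∈ Finset.range p, φ j y)) p := by
  induction p with
  | zero => simpa [mono_id_zero] using impl_one
  | succ p ih =>
    simpa only [Finset.sum_range_succ] using
      (ih fun j hj => h j (by omega)).diag_add (h p (by omega))

lemma impl_phase {n : ℕ} (k : ℕ) (hk : 1 ≤ k) (i : Fin n) :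
    Impl (mono id (fun y => Real.pi / 2 ^ k * bit (y i))) 1 := by
  rw [← embed_Zg_eq_mono]
  exact Impl.gate (.z k i) hk

lemma impl_phase_xor {n : ℕ} (k : ℕ) (hk : 1 ≤ k) (i t : Fin n) (hit : i ≠ t) :
    Impl (mono id (fun y => Real.pi / 2 ^ k * bit (xor (y t) (y i)))) 1 := by
  have := ((impl_cnot i t hit).mul (impl_phase k hk t)).mul (impl_cnot i t hit)
  simp only [mono_mul] at this
  convert this using 2
  · funext y
    simp [hit]
  · funext y
    simp

/-! ### The controlled counter

Qubit `0` controls the increment of the integer stored in qubits `1, …, p`. -/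

/-- The `j`-th qubit. -/
def qubit (n : ℕ) [NeZero n] (j : ℕ) : Fin n := Fin.ofNat n j

lemma qubit_ne {n : ℕ} [NeZero n] {i j : ℕ} (hi : i < n) (hj : j < n) (h : i ≠ j) :
    qubit n i ≠ qubit n j := by
  simpa [qubit, Fin.ext_iff, Nat.mod_eq_of_lt hi, Nat.mod_eq_of_lt hj] using h

/-- The integer stored in qubits `1, …, p`, least significant bit first. -/
def counter (n : ℕ) [NeZero n] (p : ℕ) (y : Fin n → Bool) : ℝ :=
  ∑ j ∈ Finset.range p, 2 ^ j * bit (y (qubit n (j + 1)))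

/-- The integer stored in qubits `1, …, p`, each XORed with qubit `p + 1`. -/
def xorCounter (n : ℕ) [NeZero n] (p : ℕ) (y : Fin n → Bool) : ℝ :=
  ∑ j ∈ Finset.range p, 2 ^ j * bit (xor (y (qubit n (p + 1))) (y (qubit n (j + 1))))

/-- Whether the qubits `0, …, p` are all set. -/
def allSet (n : ℕ) [NeZero n] (p : ℕ) (y : Fin n → Bool) : Bool :=
  decide (∀ j ≤ p, y (qubit n j) = true)

lemma allSet_succ {n : ℕ} [NeZero n] (p : ℕ) (y : Fin n → Bool) :
    allSet n (p + 1) y = (y (qubit n (p + 1)) && allSet n p y) := by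
  rw [Bool.eq_iff_iff]
  simp only [allSet, decide_eq_true_eq, Bool.and_eq_true]
  constructor
  · exact fun h => ⟨h _ le_rfl, fun j hj => h j (by omega)⟩
  · rintro ⟨h1, h2⟩ j hj
    rcases Nat.lt_or_eq_of_le hj with h | rfl
    exacts [h2 j (by omega), h1]

lemma allSet_update {n : ℕ} [NeZero n] {p i : ℕ} (hp : p < i) (hi : i < n)
    (y : Fin n → Bool) (b : Bool) :
    allSet n p (Function.update y (qubit n i) b) = allSet n p y := by
  have : ∀ j ≤ p, Function.update y (qubit n i) b (qubit n j) = y (qubit n j) := fun j hj =>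
    Function.update_of_ne (qubit_ne (by omega) hi (by omega)) _ _
  simp +contextual only [allSet, this]

lemma counter_update {n : ℕ} [NeZero n] {p i : ℕ} (hp : p < i) (hi : i < n)
    (y : Fin n → Bool) (b : Bool) :
    counter n p (Function.update y (qubit n i) b) = counter n p y := by
  refine Finset.sum_congr rfl fun j hj => ?_
  have hj := Finset.mem_range.1 hj
  rw [Function.update_of_ne (qubit_ne (by omega) hi (by omega))]

lemma xorCounter_eq {n : ℕ} [NeZero n] (p : ℕ) (y : Fin n → Bool) :
    xorCounter n p y = (2 ^ p - 1) * bit (y (qubit n (p + 1))) + counter n p y -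
      2 * (bit (y (qubit n (p + 1))) * counter n p y) := by
  have h : ∑ j ∈ Finset.range p, (2 : ℝ) ^ j = 2 ^ p - 1 := by
    rw [geom_sum_eq (by norm_num)]
    norm_num
  rw [← h, xorCounter, counter, Finset.sum_mul, Finset.mul_sum, Finset.mul_sum,
    ← Finset.sum_add_distrib, ← Finset.sum_sub_distrib]
  refine Finset.sum_congr rfl fun j _ => ?_
  rw [bit_xor]
  ring

lemma pi_div_two_pow_mul {p j : ℕ} (h : j ≤ p) (x : ℝ) :
    Real.pi / 2 ^ p * (2 ^ j * x) = Real.pi / 2 ^ (p - j) * x := by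
  have : (2 : ℝ) ^ p = 2 ^ (p - j) * 2 ^ j := by rw [← pow_add, Nat.sub_add_cancel h]
  rw [this]
  field_simp

lemma impl_counter {n : ℕ} [NeZero n] (p : ℕ) :
    Impl (mono id (fun y => Real.pi / 2 ^ (p + 1) * counter n p y)) p := by
  simp only [counter, Finset.mul_sum]
  refine Impl.diag_sum _ p fun j hj => ?_
  simp only [pi_div_two_pow_mul (show j ≤ p + 1 by omega)]
  exact impl_phase _ (by omega) _

lemma impl_xorCounter {n : ℕ} [NeZero n] (p : ℕ) (hp : p + 1 < n) :
    Impl (mono id (fun y => Real.pi / 2 ^ (p + 1) * xorCounter n p y)) p := by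
  simp only [xorCounter, Finset.mul_sum]
  refine Impl.diag_sum _ p fun j hj => ?_
  simp only [pi_div_two_pow_mul (show j ≤ p + 1 by omega)]
  exact impl_phase_xor _ (by omega) _ _ (qubit_ne (by omega) hp (by omega))

/-- `σ` increments the `p`-bit counter modulo `2 ^ p` when qubit `0` is set. -/
structure IsCounter (n : ℕ) [NeZero n] (p : ℕ) (σ : (Fin n → Bool) → (Fin n → Bool)) : Prop where
  update : ∀ i, p < i → i < n → ∀ y b,
    σ (Function.update y (qubit n i) b) = Function.update (σ y) (qubit n i) b
  control : ∀ y, σ y (qubit n 0) = y (qubit n 0)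
  carry : ∀ y, bit (y (qubit n 0)) + counter n p y - counter n p (σ y) =
    2 ^ p * bit (allSet n p y)

lemma IsCounter.apply {n : ℕ} [NeZero n] {p : ℕ} {σ : (Fin n → Bool) → (Fin n → Bool)}
    (h : IsCounter n p σ) {i : ℕ} (hp : p < i) (hi : i < n) (y : Fin n → Bool) :
    σ y (qubit n i) = y (qubit n i) := by
  simpa using congrFun (h.update i hp hi y (y (qubit n i))) (qubit n i)

lemma IsCounter.succ {n : ℕ} [NeZero n] {p : ℕ} {σ : (Fin n → Bool) → (Fin n → Bool)}
    (h : IsCounter n p σ) (hp : p + 1 < n) :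
    IsCounter n (p + 1) (fun y => Function.update (σ y) (qubit n (p + 1))
      (xor (y (qubit n (p + 1))) (allSet n p y))) where
  update i hpi hi y b := by
    have hne : qubit n i ≠ qubit n (p + 1) := qubit_ne hi hp (by omega)
    simp only [h.update i (by omega) hi, allSet_update (show p < i by omega) hi,
      Function.update_of_ne hne.symm]
    rw [Function.update_comm hne]
  control y := by
    rw [Function.update_of_ne (qubit_ne (by omega) hp (by omega)), h.control]
  carry y := by
    have hc : ∀ z : Fin n → Bool, counter n (p + 1) z =
        counter n p z + 2 ^ p * bit (z (qubit n (p + 1))) := fun z => Finset.sum_range_succ _ _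
    have h1 := h.carry y
    rw [hc, hc, counter_update (Nat.lt_succ_self p) hp, Function.update_self, allSet_succ, bit_xor]
    have h2 : bit (y (qubit n (p + 1)) && allSet n p y) =
        bit (y (qubit n (p + 1))) * bit (allSet n p y) := by
      cases y (qubit n (p + 1)) <;> simp
    rw [h2, pow_succ]
    linear_combination h1

/-- The controlled counter is realized, up to relative phases, with quadratically many phase
gates. -/
lemma exists_isCounter {n : ℕ} [NeZero n] (r : ℕ) (hr : r + 1 < n) :
    ∃ σ φ, IsCounter n (r + 1) σ ∧ Impl (mono σ φ) (r * (r + 3)) ∧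
      ∀ i, r + 1 < i → i < n → ∀ y b, φ (Function.update y (qubit n i) b) = φ y := by
  induction r with
  | zero =>
    have h01 : qubit n 0 ≠ qubit n 1 := qubit_ne (by omega) (by omega) (by omega)
    refine ⟨_, _, ?_, by simpa using impl_cnot _ _ h01, by simp⟩
    have h0 : IsCounter n 0 id := by
      refine ⟨by simp, by simp, fun y => ?_⟩
      simp [counter, allSet]
    have := h0.succ hr
    simpa [allSet] using this
  | succ r ih =>
    obtain ⟨σ, φ, hσ, hI, hφ⟩ := ih (by omega)
    set t := qubit n (r + 2) with ht
    have h0t : qubit n 0 ≠ t := qubit_ne (by omega) hr (by omega)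
    have key := hadamard_conj t σ
      (fun y => Real.pi / 2 ^ (r + 2) * xorCounter n (r + 1) (σ y) + (φ y +
        (-(Real.pi / 2 ^ (r + 2) * xorCounter n (r + 1) y) +
          (Real.pi / 2 ^ (r + 2) * bit (y t) +
            -(Real.pi / 2 ^ (r + 2) * bit (xor (y t) (y (qubit n 0))))))))
      (fun y => φ y - Real.pi / 2 * bit (allSet n (r + 1) y)) (allSet n (r + 1))
      (fun y => by
        have h1 := hσ.carry y
        rw [xorCounter_eq, xorCounter_eq, hσ.apply (Nat.lt_succ_self _) hr, bit_xor, ← ht]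
        have h2 : Real.pi / 2 ^ (r + 2) * 2 ^ (r + 1) * 2 = Real.pi := by
          rw [mul_assoc, ← pow_succ]
          exact div_mul_cancel₀ _ (by positivity)
        linear_combination Real.pi / 2 ^ (r + 2) * (2 * bit (y t) - 1) * h1 +
          (bit (y t) - 1 / 2) * bit (allSet n (r + 1) y) * h2)
      (hσ.update _ (Nat.lt_succ_self _) hr)
      (fun y b => by
        simp only [ht, hφ _ (Nat.lt_succ_self _) hr, allSet_update (Nat.lt_succ_self _) hr])
      (allSet_update (Nat.lt_succ_self _) hr)
    refine ⟨_, fun y => φ y - Real.pi / 2 * bit (allSet n (r + 1) y), hσ.succ hr, ?_, ?_⟩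
    · rw [← key]
      have hd := (impl_xorCounter (n := n) (r + 1) hr).diag_neg.diag_add
        ((impl_phase (r + 2) (by omega) t).diag_add
          (impl_phase_xor (r + 2) (by omega) _ _ h0t).diag_neg)
      have := (impl_hadamard t).mul
        (((impl_xorCounter (n := n) (r + 1) hr).mul (hI.mul hd)).mul (impl_hadamard t))
      simp only [mono_mul, Function.id_comp, Function.comp_id, id] at this
      convert this using 1
      ring
    · intro i hi hin y b
      simp only [hφ i (by omega) hin, allSet_update (show r + 1 < i by omega) hin]

lemma mct_eq_mono {n : ℕ} [NeZero n] (p : ℕ) (hp : p + 2 = n) :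
    mct n = mono (fun y => Function.update y (qubit n (p + 1))
      (xor (y (qubit n (p + 1))) (allSet n p y))) (fun _ => 0) := by
  have hf : mctFun n = fun y => Function.update y (qubit n (p + 1))
      (xor (y (qubit n (p + 1))) (allSet n p y)) := by
    funext y k
    have hq : ∀ k : Fin n, qubit n k = k := fun k => by simp [qubit]
    have ha : (decide (∀ j : Fin n, (j : ℕ) < n - 1 → y j = true)) = allSet n p y := by
      rw [allSet, decide_eq_decide]
      constructor
      · intro h j hj
        refine h _ ?_
        simp only [qubit, Fin.val_ofNat, Nat.mod_eq_of_lt (show j < n by omega)]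
        omega
      · intro h j hj
        rw [← hq j]
        exact h j (by omega)
    by_cases hk : (k : ℕ) = n - 1
    · have : k = qubit n (p + 1) := by
        rw [← hq k, hk]
        congr 1
        omega
      subst this
      simp only [mctFun, hk, if_true, ha, Function.update_self]
    · have : k ≠ qubit n (p + 1) := by
        intro h
        apply hk
        rw [h, qubit, Fin.val_ofNat, Nat.mod_eq_of_lt (by omega)]
        omega
      simp [mctFun, hk, this]
  ext x y
  simp [mct, mono, hf]

/-- The multiply controlled sign gate on all qubits, from the controlled counter. -/
lemma impl_multi_cz {n : ℕ} [NeZero n] (r : ℕ) (hr : r + 2 < n) :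
    Impl (mono (n := n) id (fun y => Real.pi *
      (bit (y (qubit n (r + 2))) * bit (allSet n (r + 1) y)))) (2 * r * (r + 3) + 4 * r + 7) := by
  obtain ⟨σ, φ, hσ, hI, -⟩ := exists_isCounter (n := n) r (by omega)
  obtain ⟨N, hN, hNI⟩ := hI.exists_inv
  set t := qubit n (r + 2) with ht
  have h0t : qubit n 0 ≠ t := qubit_ne (by omega) hr (by omega)
  have hx := impl_xorCounter (n := n) (r + 1) hr
  have hc := impl_counter (n := n) (r + 1)
  have h₂ := hx.diag_add hc.diag_neg
  have h₁ := (hx.diag_neg.diag_add hc).diag_add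
    (((impl_phase (r + 2) (by omega) t).diag_add
      (impl_phase (r + 2) (by omega) (qubit n 0))).diag_add
      (impl_phase_xor (r + 2) (by omega) _ _ h0t).diag_neg)
  have h := (hNI.mul (h₂.mul hI)).mul h₁
  have hcomm : ∀ ψ : (Fin n → Bool) → ℝ, mono id ψ * mono σ φ =
      mono σ φ * mono id (fun y => ψ (σ y)) := by
    intro ψ
    simp [mono_mul, add_comm]
  rw [hcomm, ← mul_assoc N, hN, one_mul, mono_mul] at h
  convert h using 1
  · congr 1
    funext y
    have h1 := hσ.carry y
    simp only [id]
    rw [xorCounter_eq, xorCounter_eq, hσ.apply (Nat.lt_succ_self _) hr, bit_xor, ← ht]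
    have h2 : Real.pi / 2 ^ (r + 2) * 2 ^ (r + 1) * 2 = Real.pi := by
      rw [mul_assoc, ← pow_succ]
      exact div_mul_cancel₀ _ (by positivity)
    linear_combination -(Real.pi / 2 ^ (r + 2) * (2 * bit (y t))) * h1 -
      bit (y t) * bit (allSet n (r + 1) y) * h2
  · ring

/-- For every `n ≥ 4` there is a finite list of Clifford+`Z_N` gates on exactly `n`
qubits (no ancilla) whose product is the `n`-MCT matrix and whose number of phase
gate entries is at most `2n² + n − 16`, i.e. the phase count is `O(n²)`. -/
theorem mct_cliffordZN_phase_count :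
    ∀ n : ℕ, 4 ≤ n → ∃ L : List (GateDesc n),
      (∀ g ∈ L, g.valid) ∧
      (L.map GateDesc.interp).prod = mct n ∧
      (L.countP GateDesc.isPhase : ℤ) ≤ 2 * (n : ℤ) ^ 2 + n - 16 := by
  intro n hn
  obtain ⟨r, rfl⟩ : ∃ r, n = r + 3 := ⟨n - 3, by omega⟩
  have hlt : r + 2 < r + 3 := by omega
  have key := hadamard_conj (qubit (r + 3) (r + 2)) id _ (fun _ => 0) (allSet (r + 3) (r + 1))
    (fun y => (zero_add _).symm) (by simp) (by simp) (allSet_update (Nat.lt_succ_self _) hlt)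
  have h := (impl_hadamard (qubit (r + 3) (r + 2))).mul
    ((impl_multi_cz r hlt).mul (impl_hadamard (qubit (r + 3) (r + 2))))
  rw [key] at h
  obtain ⟨L, h1, h2, h3⟩ := h
  refine ⟨L, h1, ?_, ?_⟩
  · rw [h2, mct_eq_mono (r + 1) rfl]
    rfl
  · have h4 : (L.countP GateDesc.isPhase : ℤ) ≤ 0 + (2 * r * (r + 3) + 4 * r + 7 + 0) := by
      exact_mod_cast h3
    push_cast
    nlinarith

end MCT
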